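/- arXiv:2604.02561 — 3 statements merged into one kernel-verified Lean document; each statement's English description precedes it below -/
import Mathlib

section
/- Let (T, ≤) be a tree, μ ∈ T and ν ∈ T ∖ {μ}. For every directed subset D ⊆ T (with respect to ≤) that has a least upper bound η in T: if η ∈ [ν]_μ, then D ∩ [ν]_μ ≠ ∅. Equivalently, if D ⊆ T ∖ [ν]_μ is directed with least upper bound η, then η ∉ [ν]_μ. -/
/-- The interval `[a, b]` in a tree whose infimum operation is `inf`:
`{η : a∧b ≤ η ≤ a or a∧b ≤ η ≤ b}`. -/
def treeInterval {T : Type*} [PartialOrder T] (inf : T → T → T) (a b : T) : Set T :=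
  {x | (inf a b ≤ x ∧ x ≤ a) ∨ (inf a b ≤ x ∧ x ≤ b)}

/-- The class `[ν]_μ = {η ∈ T ∖ {μ} : μ ∉ [ν, η]}`. -/
def treeClass {T : Type*} [PartialOrder T] (inf : T → T → T) (μ ν : T) : Set T :=
  {η | η ≠ μ ∧ μ ∉ treeInterval inf ν η}

/-- In a tree `(T, ≤)`, for `μ ∈ T` and `ν ∈ T ∖ {μ}`, the set `[ν]_μ` is inaccessible by
directed joins: for every (nonempty) directed set `D ⊆ T` having a least upper bound `η`,
if `η ∈ [ν]_μ` then `D ∩ [ν]_μ ≠ ∅`. -/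
theorem treeClass_inaccessible_by_directed_joins
    {T : Type*} [PartialOrder T]
    (inf : T → T → T)
    (hchain : ∀ μ a b : T, a ≤ μ → b ≤ μ → a ≤ b ∨ b ≤ a)
    (hinf : ∀ a b : T, IsGLB {a, b} (inf a b))
    (μ ν : T) (hν : ν ≠ μ)
    (D : Set T) (hne : D.Nonempty)
    (hdir : ∀ a ∈ D, ∀ b ∈ D, ∃ c ∈ D, a ≤ c ∧ b ≤ c)
    (η : T) (hlub : IsLUB D η) (hη : η ∈ treeClass inf μ ν) :
    (D ∩ treeClass inf μ ν).Nonempty := by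
  have hl : ∀ a b, inf a b ≤ a := fun a b => (hinf a b).1 (by simp)
  have hr : ∀ a b, inf a b ≤ b := fun a b => (hinf a b).1 (by simp)
  have hg : ∀ a b c, c ≤ a → c ≤ b → c ≤ inf a b := fun a b c h1 h2 =>
    (hinf a b).2 (by
      rintro x (rfl | rfl)
      · exact h1
      · exact h2)
  obtain ⟨hημ, hη2⟩ := hη
  by_cases hμν : μ ≤ ν
  · have h1 : ¬ inf ν η ≤ μ := fun h => hη2 (Or.inl ⟨h, hμν⟩)
    have h2 : μ ≤ inf ν η := (hchain ν _ _ hμν (hl ν η)).resolve_right h1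
    have h3 : μ ≤ η := h2.trans (hr ν η)
    have h4 : ∃ d ∈ D, ¬ d ≤ μ := by
      by_contra hcon
      have hub : η ≤ μ := hlub.2 (fun d hd => by
        by_contra hd2
        exact hcon ⟨d, hd, hd2⟩)
      exact hημ (le_antisymm hub h3)
    obtain ⟨d, hd, hdμ⟩ := h4
    have h5 : ¬ inf ν d ≤ μ := by
      intro h
      rcases hchain η d (inf ν η) (hlub.1 hd) (hr ν η) with h6 | h6
      · exact hdμ ((hg ν d d (h6.trans (hl ν η)) le_rfl).trans h)
      · exact h1 ((hg ν d _ (hl ν η) h6).trans h)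
    refine ⟨d, hd, fun h => hdμ h.le, ?_⟩
    rintro (h | h)
    · exact h5 h.1
    · exact h5 h.1
  · have h1 : ¬ μ ≤ η := by
      intro h
      rcases hchain η μ (inf ν η) h (hr ν η) with h6 | h6
      · exact hμν (h6.trans (hl ν η))
      · exact hη2 (Or.inr ⟨h6, h⟩)
    obtain ⟨d, hd⟩ := hne
    have h2 : ¬ μ ≤ d := fun h => h1 (h.trans (hlub.1 hd))
    refine ⟨d, hd, fun h => h2 h.ge, ?_⟩
    rintro (h | h)
    · exact hμν h.2
    · exact h2 h.2
end

section
/- Let (T, ≤) be a tree equipped with the weak tree topology, let I be a directed set, and let (ν_i)_{i∈I} be an increasing net in T (ν_i ≤ ν_j whenever i ≤ j in I). If the net (ν_i)_{i∈I} converges to ν ∈ T in the weak tree topology, then ν_i ≤ ν for every i ∈ I. -/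
/-- The weak tree topology: generated by the subbasis of all sets `[ν]_μ`. -/
def weakTreeTopology {T : Type*} [PartialOrder T] (inf : T → T → T) : TopologicalSpace T :=
  TopologicalSpace.generateFrom {U | ∃ μ ν : T, ν ≠ μ ∧ U = treeClass inf μ ν}

/-- In a tree `(T, ≤)` with the weak tree topology, if an increasing net `(ν_i)_{i ∈ I}`
converges to `ν`, then `ν_i ≤ ν` for every `i`. -/
theorem limit_is_upper_bound_weakTree
    {T : Type*} [PartialOrder T]
    (hchain : ∀ μ a b : T, a ≤ μ → b ≤ μ → a ≤ b ∨ b ≤ a)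
    (inf : T → T → T)
    (hinf : ∀ a b : T, IsGLB {a, b} (inf a b))
    {I : Type*} [Preorder I] [Nonempty I]
    (hIdir : ∀ i j : I, ∃ k : I, i ≤ k ∧ j ≤ k)
    (f : I → T) (hmono : ∀ i j : I, i ≤ j → f i ≤ f j)
    (ν : T)
    (hlim : ∀ U : Set T, (weakTreeTopology inf).IsOpen U → ν ∈ U →
      ∃ i₀ : I, ∀ j : I, i₀ ≤ j → f j ∈ U) :
    ∀ i : I, f i ≤ ν := by
  intro i
  by_contra hi
  have hne : ν ≠ f i := fun h => hi h.symm.le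
  have hopen : (weakTreeTopology inf).IsOpen (treeClass inf (f i) ν) :=
    TopologicalSpace.GenerateOpen.basic _ ⟨f i, ν, hne, rfl⟩
  have hmem : ν ∈ treeClass inf (f i) ν := by
    refine ⟨hne, ?_⟩
    rintro (h | h)
    · exact hi h.2
    · exact hi h.2
  obtain ⟨i₀, h₀⟩ := hlim _ hopen hmem
  obtain ⟨k, hik, h0k⟩ := hIdir i i₀
  have hfk := hmono i k hik
  have hl : inf ν (f k) ≤ ν := (hinf ν (f k)).1 (by simp)
  have hr : inf ν (f k) ≤ f k := (hinf ν (f k)).1 (by simp)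
  refine (h₀ k h0k).2 (Or.inr ⟨?_, hfk⟩)
  rcases hchain (f k) _ _ hr hfk with h | h
  · exact h
  · exact absurd (h.trans hl) hi
end

section
/- Let (T, ≤) be a tree equipped with the weak tree topology, let I be a directed set, and let (ν_i)_{i∈I} be an increasing net in T (ν_i ≤ ν_j whenever i ≤ j in I). If μ is a supremum of the family {ν_i : i ∈ I}, then the net (ν_i)_{i∈I} converges to μ in the weak tree topology, and μ is its unique limit: every ν ∈ T to which the net converges equals μ. -/
/-- `μ` is a supremum of `C`: an upper bound of `C` such that any upper bound `μ' ≤ μ`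
equals `μ`. -/
def IsSupremumOf {T : Type*} [PartialOrder T] (C : Set T) (μ : T) : Prop :=
  (∀ c ∈ C, c ≤ μ) ∧ ∀ μ' : T, (∀ c ∈ C, c ≤ μ') → μ' ≤ μ → μ' = μ

/-- In a tree `(T, ≤)` with the weak tree topology, if `μ` is a supremum of an increasing
net `(ν_i)_{i ∈ I}`, then the net converges to `μ` in the weak tree topology, and `μ` is
the unique limit of the net. -/
theorem increasing_net_tendsto_sup_weakTree
    {T : Type*} [PartialOrder T]
    (hchain : ∀ μ a b : T, a ≤ μ → b ≤ μ → a ≤ b ∨ b ≤ a)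
    (inf : T → T → T)
    (hinf : ∀ a b : T, IsGLB {a, b} (inf a b))
    {I : Type*} [Preorder I] [Nonempty I]
    (hIdir : ∀ i j : I, ∃ k : I, i ≤ k ∧ j ≤ k)
    (f : I → T) (hmono : ∀ i j : I, i ≤ j → f i ≤ f j)
    (μ : T) (hsup : IsSupremumOf (Set.range f) μ) :
    (∀ U : Set T, (weakTreeTopology inf).IsOpen U → μ ∈ U →
      ∃ i₀ : I, ∀ j : I, i₀ ≤ j → f j ∈ U) ∧
    (∀ ν : T, (∀ U : Set T, (weakTreeTopology inf).IsOpen U → ν ∈ U →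
      ∃ i₀ : I, ∀ j : I, i₀ ≤ j → f j ∈ U) → ν = μ) := by
  have il : ∀ a b, inf a b ≤ a := fun a b => (hinf a b).1 (by simp)
  have ir : ∀ a b, inf a b ≤ b := fun a b => (hinf a b).1 (by simp)
  have li : ∀ a b c, c ≤ a → c ≤ b → c ≤ inf a b := fun a b c h1 h2 =>
    (hinf a b).2 (by rintro x (rfl | rfl) <;> assumption)
  obtain ⟨hub, hmin⟩ := hsup
  have hle : ∀ i, f i ≤ μ := fun i => hub _ ⟨i, rfl⟩
  have hself : ∀ a ν : T, ν ≠ a → ν ∈ treeClass inf a ν := by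
    intro a ν h
    refine ⟨h, ?_⟩
    have h3 := li ν ν ν le_rfl le_rfl
    rintro (⟨h1, h2⟩ | ⟨h1, h2⟩) <;> exact h (le_antisymm (h3.trans h1) h2)
  constructor
  · intro U hU
    change TopologicalSpace.GenerateOpen _ U at hU
    induction hU with
    | basic s hs =>
      obtain ⟨a, b, hab, rfl⟩ := hs
      rintro ⟨hne, hnot⟩
      by_cases ha : a ≤ μ
      · have hex : ∃ i, ¬ f i ≤ a := by
          by_contra hcon
          push Not at hcon
          exact hne (hmin a (by rintro _ ⟨i, rfl⟩; exact hcon i) ha).symm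
        obtain ⟨i, hi⟩ := hex
        refine ⟨i, fun j hij => ?_⟩
        have hj : ¬ f j ≤ a := fun h => hi ((hmono i j hij).trans h)
        refine ⟨fun h => hj h.le, fun hmem => ?_⟩
        have h1 : inf b (f j) ≤ a := by rcases hmem with h | h <;> exact h.1
        rcases hchain μ _ _ (ir b μ) (hle j) with h | h
        · exact hnot (Or.inr ⟨(li _ _ _ (il b μ) h).trans h1, ha⟩)
        · exact hj ((li _ _ _ (h.trans (il b μ)) le_rfl).trans h1)
      · obtain ⟨i⟩ := ‹Nonempty I›
        refine ⟨i, fun j _ => ⟨fun h => ha (h ▸ hle j), ?_⟩⟩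
        rintro (⟨_, h2⟩ | ⟨_, h2⟩)
        · rcases hchain b _ _ (il b μ) h2 with h | h
          · exact hnot (Or.inl ⟨h, h2⟩)
          · exact ha (h.trans (ir b μ))
        · exact ha (h2.trans (hle j))
    | univ =>
      intro _
      obtain ⟨i⟩ := ‹Nonempty I›
      exact ⟨i, fun _ _ => trivial⟩
    | inter s t _ _ ihs iht =>
      rintro ⟨h1, h2⟩
      obtain ⟨i, hi⟩ := ihs h1
      obtain ⟨j, hj⟩ := iht h2
      obtain ⟨k, hik, hjk⟩ := hIdir i j
      exact ⟨k, fun l hl => ⟨hi l (hik.trans hl), hj l (hjk.trans hl)⟩⟩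
    | sUnion S _ ih =>
      rintro ⟨s, hs, hm⟩
      obtain ⟨i, hi⟩ := ih s hs hm
      exact ⟨i, fun j hj => ⟨s, hs, hi j hj⟩⟩
  · intro ν hν
    have hopen : ∀ a : T, ν ≠ a → ∃ i₀ : I, ∀ j : I, i₀ ≤ j → f j ∈ treeClass inf a ν :=
      fun a h => hν _ (TopologicalSpace.GenerateOpen.basic _ ⟨a, ν, h, rfl⟩) (hself a ν h)
    by_contra hne
    by_cases hall : ∀ i, f i ≤ ν
    · have hm : inf μ ν = μ :=
        hmin _ (by rintro _ ⟨i, rfl⟩; exact li _ _ _ (hle i) (hall i)) (il _ _)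
      have hμν : μ ≤ ν := hm ▸ ir μ ν
      obtain ⟨i, hi⟩ := hopen μ hne
      exact (hi i le_rfl).2 (Or.inl ⟨(ir _ _).trans (hle i), hμν⟩)
    · push Not at hall
      obtain ⟨i, hi⟩ := hall
      obtain ⟨k, hk⟩ := hopen (f i) (fun h => hi h.ge)
      obtain ⟨j, hij, hkj⟩ := hIdir i k
      rcases hchain (f j) _ _ (ir ν (f j)) (hmono i j hij) with h | h
      · exact (hk j hkj).2 (Or.inr ⟨h, hmono i j hij⟩)
      · exact hi (h.trans (il _ _))
end
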